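/- Consider the problem in ℝ² of minimizing f(x) = x₂ subject to g₁(x) = x₁² + (x₂ − 1)² − 1 ≤ 0 and g₂(x) = 1 − x₁² − (x₂ + 1)² ≤ 0, and let x* = (0, 0). The strong critical cone at x* is C^S(x*) = { d ∈ ℝ² : d₂ = 0 }, and there exist KKT multipliers (μ₁, μ₂) ∈ ℝ₊² at x* (namely any with μ₁ < μ₂ and 2(μ₁ + μ₂) = 1) and a direction d ∈ C^S(x*) such that dᵀ(∇²f(x*) + μ₁∇²g₁(x*) + μ₂∇²g₂(x*))d < 0. Hence the strong second-order necessary condition (SSONC) fails at the global minimizer x*, even though MFCQ holds there; in particular MFCQ is not a second-order constraint qualification. -/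

import Mathlib

open Filter Topology Set

/-- Objective `f(x) = x₂` of the example problem. -/
def fEx (x : ℝ × ℝ) : ℝ := x.2

/-- First constraint `g₁(x) = x₁² + (x₂ − 1)² − 1`. -/
def g1Ex (x : ℝ × ℝ) : ℝ := x.1 ^ 2 + (x.2 - 1) ^ 2 - 1

/-- Second constraint `g₂(x) = 1 − x₁² − (x₂ + 1)²`. -/
def g2Ex (x : ℝ × ℝ) : ℝ := 1 - x.1 ^ 2 - (x.2 + 1) ^ 2

/-- The quadratic form `d ↦ dᵀ ∇²φ(x) d` of the Hessian of `φ` at `x`. -/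
noncomputable def hessQuad (φ : ℝ × ℝ → ℝ) (x d : ℝ × ℝ) : ℝ :=
  fderiv ℝ (fun y => fderiv ℝ φ y d) x d

theorem fderiv_fEx (x d : ℝ × ℝ) : fderiv ℝ fEx x d = d.2 := by
  have h : HasFDerivAt fEx (ContinuousLinearMap.snd ℝ ℝ ℝ) x := hasFDerivAt_snd
  rw [h.fderiv]
  rfl

theorem fderiv_g1Ex (x d : ℝ × ℝ) :
    fderiv ℝ g1Ex x d = 2 * x.1 * d.1 + 2 * (x.2 - 1) * d.2 := by
  have hs : HasFDerivAt Prod.snd (ContinuousLinearMap.snd ℝ ℝ ℝ) x := hasFDerivAt_snd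
  have h : HasFDerivAt g1Ex _ x :=
    ((hasFDerivAt_fst.pow 2).add ((hs.sub_const 1).pow 2)).sub_const 1
  rw [h.fderiv]
  simp

theorem fderiv_g2Ex (x d : ℝ × ℝ) :
    fderiv ℝ g2Ex x d = -(2 * x.1 * d.1) - 2 * (x.2 + 1) * d.2 := by
  have hs : HasFDerivAt Prod.snd (ContinuousLinearMap.snd ℝ ℝ ℝ) x := hasFDerivAt_snd
  have h : HasFDerivAt g2Ex _ x :=
    ((hasFDerivAt_fst.pow 2).const_sub 1).sub ((hs.add_const 1).pow 2)
  rw [h.fderiv]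
  simp [mul_add]

theorem hessQuad_fEx (x d : ℝ × ℝ) : hessQuad fEx x d = 0 := by
  simp [hessQuad, fderiv_fEx]

theorem hessQuad_g2Ex (x d : ℝ × ℝ) :
    hessQuad g2Ex x d = -(2 * (d.1 ^ 2 + d.2 ^ 2)) := by
  have hs : HasFDerivAt Prod.snd (ContinuousLinearMap.snd ℝ ℝ ℝ) x := hasFDerivAt_snd
  have h : HasFDerivAt (fun y : ℝ × ℝ => -(2 * y.1 * d.1) - 2 * (y.2 + 1) * d.2) _ x :=
    ((hasFDerivAt_fst.const_mul 2).mul_const d.1).neg.sub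
      (((hs.add_const 1).const_mul 2).mul_const d.2)
  simp only [hessQuad, fderiv_g2Ex]
  rw [h.fderiv]
  simp
  ring

/-- **Example (MFCQ is not a second-order CQ).** At `x✶ = (0,0)`, both constraints are
active, the strong critical cone is `{d : d₂ = 0}`, MFCQ holds, and there are KKT
multipliers `(μ₁, μ₂)` (with `μ₁ < μ₂`, `2(μ₁ + μ₂) = 1`) and a critical direction `d`
with `dᵀ∇²ₓₓℓ(x✶, μ)d < 0`.  Hence SSONC fails at the global minimizer `x✶` even
though MFCQ holds there. -/
theorem example_ssonc_fails_under_mfcq :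
    (g1Ex (0, 0) = 0 ∧ g2Ex (0, 0) = 0) ∧
    ({d : ℝ × ℝ | fderiv ℝ g1Ex (0, 0) d ≤ 0 ∧ fderiv ℝ g2Ex (0, 0) d ≤ 0 ∧
        fderiv ℝ fEx (0, 0) d ≤ 0} = {d : ℝ × ℝ | d.2 = 0}) ∧
    (∃ d : ℝ × ℝ, fderiv ℝ g1Ex (0, 0) d < 0 ∧ fderiv ℝ g2Ex (0, 0) d < 0) ∧
    (∃ μ₁ μ₂ : ℝ, 0 ≤ μ₁ ∧ 0 ≤ μ₂ ∧ μ₁ < μ₂ ∧ 2 * (μ₁ + μ₂) = 1 ∧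
      (fderiv ℝ fEx (0, 0) + μ₁ • fderiv ℝ g1Ex (0, 0) +
        μ₂ • fderiv ℝ g2Ex (0, 0) = 0) ∧
      ∃ d : ℝ × ℝ, d.2 = 0 ∧
        hessQuad fEx (0, 0) d + μ₁ * hessQuad g1Ex (0, 0) d +
          μ₂ * hessQuad g2Ex (0, 0) d < 0) := by
  refine ⟨by norm_num [g1Ex, g2Ex], ?_, ⟨(0, 1), ?_⟩, 0, 1 / 2, by norm_num, by norm_num,
    by norm_num, by norm_num, ?_, (1, 0), rfl, ?_⟩
  · ext d
    simp only [fderiv_fEx, fderiv_g1Ex, fderiv_g2Ex, mem_ofPred_eq]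
    constructor
    · rintro ⟨h₁, -, h₀⟩
      linarith
    · intro h
      simp [h]
  · norm_num [fderiv_g1Ex, fderiv_g2Ex]
  · refine ContinuousLinearMap.ext fun d => ?_
    simp only [add_apply, smul_apply, zero_apply,
      fderiv_fEx, fderiv_g1Ex, fderiv_g2Ex, smul_eq_mul]
    ring
  · norm_num [hessQuad_fEx, hessQuad_g2Ex]
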